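/- arXiv:0911.5526 — 4 statements merged into one kernel-verified Lean document; each statement's English description precedes it below -/
import Mathlib

section
/- Let k ≥ 3 be an odd integer and let C_k be the cycle graph on k vertices with the uniform distribution over its k edges. Then sdp₃(C_k) ≤ 1 − 1/k. -/
open Finset

/-- Feasible solutions of the Goemans–Williamson Max-Cut relaxation strengthened by the
`ℓ₂²` triangle inequalities: positive semidefinite matrices with unit diagonal satisfying
`X_{ij}+X_{jk}−X_{ik} ≤ 1` and `X_{ij}+X_{jk}+X_{ik} ≥ −1` for all `i,j,k`. -/
def Sdp3Feasible {V : Type} [Fintype V] (X : Matrix V V ℝ) : Prop :=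
  X.PosSemidef ∧ (∀ i, X i i = 1) ∧
    (∀ i j k, X i j + X j k - X i k ≤ 1) ∧ (∀ i j k, -1 ≤ X i j + X j k + X i k)

/-- The value `sdp₃(G) = max E_{(u,v)∼E} ¼(X_{uu}+X_{vv}−2X_{uv})` of the triangle
inequality strengthened Max-Cut SDP, for a graph given by a (symmetrized) probability
distribution `p` over its (ordered) edges. -/
noncomputable def sdp3 {V : Type} [Fintype V] (p : V → V → ℝ) : ℝ :=
  sSup ((fun X : Matrix V V ℝ =>
    ∑ i, ∑ j, p i j * ((X i i + X j j - 2 * X i j) / 4)) '' {X | Sdp3Feasible X})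

/-- The cyclic successor on `Fin k`. -/
def cyc (k : ℕ) (t : Fin k) : Fin k :=
  ⟨((t : ℕ) + 1) % k, Nat.mod_lt _ t.pos⟩

/-- Chaining triangle inequalities along a walk of odd length. -/
lemma Sdp3Feasible.sub_le_sum_walk {V : Type} [Fintype V] {X : Matrix V V ℝ}
    (hX : Sdp3Feasible X) (v : ℕ → V) (n : ℕ) :
    X (v 0) (v (2 * n + 1)) - 2 * n ≤ ∑ t ∈ range (2 * n + 1), X (v t) (v (t + 1)) := by
  obtain ⟨hpsd, -, hle, hge⟩ := hX
  induction n with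
  | zero => simp
  | succ n ih =>
    rw [show 2 * (n + 1) + 1 = 2 * n + 1 + 1 + 1 by ring, sum_range_succ, sum_range_succ]
    have hsymm : X (v (2 * n + 1 + 1)) (v 0) = X (v 0) (v (2 * n + 1 + 1)) := by
      simpa using hpsd.isHermitian.apply (v 0) (v (2 * n + 1 + 1))
    have h₁ := hge (v 0) (v (2 * n + 1)) (v (2 * n + 1 + 1))
    have h₂ := hle (v (2 * n + 1 + 1)) (v 0) (v (2 * n + 1 + 1 + 1))
    push_cast
    linarith

lemma Sdp3Feasible.apply_le_one {V : Type} [Fintype V] {X : Matrix V V ℝ}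
    (hX : Sdp3Feasible X) (i j : V) : X i j ≤ 1 := by
  obtain ⟨hpsd, hdiag, hle, -⟩ := hX
  have hsymm : X j i = X i j := by simpa using hpsd.isHermitian.apply i j
  have h := hle i j i
  rw [hdiag, hsymm] at h
  linarith

/-- The odd cycle inequality for feasible matrices. -/
lemma Sdp3Feasible.le_sum_cyc {k : ℕ} (hodd : Odd k) {X : Matrix (Fin k) (Fin k) ℝ}
    (hX : Sdp3Feasible X) : 2 - (k : ℝ) ≤ ∑ i, X i (cyc k i) := by
  have hpos : 0 < k := hodd.pos
  let v : ℕ → Fin k := fun t => ⟨t % k, Nat.mod_lt _ hpos⟩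
  have hsum : ∑ i, X i (cyc k i) = ∑ t ∈ range k, X (v t) (v (t + 1)) := by
    rw [← Fin.sum_univ_eq_sum_range (fun t => X (v t) (v (t + 1)))]
    refine sum_congr rfl fun i _ => ?_
    have hi : v i = i := Fin.ext (Nat.mod_eq_of_lt i.isLt)
    rw [hi]
    rfl
  obtain ⟨n, hn⟩ := hodd
  have hwalk := hX.sub_le_sum_walk v n
  have hclosed : v k = v 0 := Fin.ext (by simp [v])
  rw [← hn, hclosed, hX.2.1, ← hsum] at hwalk
  have hcast : (k : ℝ) = 2 * n + 1 := by exact_mod_cast hn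
  linarith

/-- **Odd cycles and triangle inequalities.** Let `k ≥ 3` be odd and let `C_k` be the
cycle on `k` vertices with the uniform distribution over its `k` edges (mass `1/(2k)` on
each ordered edge). Then `sdp₃(C_k) ≤ 1 − 1/k`. -/
theorem odd_cycle_sdp3 (k : ℕ) (hk : 3 ≤ k) (hodd : Odd k) :
    sdp3 (fun i j : Fin k => if j = cyc k i ∨ i = cyc k j then 1 / (2 * k) else 0) ≤
      1 - 1 / k := by
  have hk0 : (0 : ℝ) < k := by exact_mod_cast hodd.pos
  have hk1 : (1 : ℝ) ≤ k := by exact_mod_cast hodd.pos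
  refine Real.sSup_le ?_ (sub_nonneg.2 ((div_le_one hk0).2 hk1))
  rintro _ ⟨X, hX : Sdp3Feasible X, rfl⟩
  have hsymm : ∀ i j, X j i = X i j := fun i j => by
    simpa using hX.1.isHermitian.apply i j
  let g : Fin k → Fin k → ℝ := fun i j => 1 / (2 * k) * ((1 - X i j) / 2)
  have hg : ∀ i j, 0 ≤ g i j := fun i j =>
    mul_nonneg (by positivity) (by linarith [hX.apply_le_one i j])
  calc ∑ i, ∑ j, (if j = cyc k i ∨ i = cyc k j then 1 / (2 * (k : ℝ)) else 0) *
        ((X i i + X j j - 2 * X i j) / 4)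
      ≤ ∑ i, ∑ j, ((if j = cyc k i then g i j else 0) +
          if i = cyc k j then g i j else 0) := by
        refine sum_le_sum fun i _ => sum_le_sum fun j _ => ?_
        have hterm : 1 / (2 * (k : ℝ)) * ((X i i + X j j - 2 * X i j) / 4) = g i j := by
          simp only [g, hX.2.1]
          ring
        rw [ite_mul, zero_mul, hterm]
        have := hg i j
        split_ifs <;> first | linarith | tauto
    _ = ∑ i, 2 * g i (cyc k i) := by
        simp only [sum_add_distrib]
        rw [sum_comm (f := fun i j => if i = cyc k j then g i j else 0),
          ← sum_add_distrib]
        refine sum_congr rfl fun i _ => ?_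
        simp only [sum_ite_eq', mem_univ, if_true, g]
        rw [hsymm i (cyc k i)]
        ring
    _ = 1 / (2 * k) * (k - ∑ i, X i (cyc k i)) := by
        have hcard : (k : ℝ) = ∑ _i : Fin k, 1 := by simp
        rw [← mul_sum, ← mul_sum, ← sum_div, sum_sub_distrib, ← hcard]
        ring
    _ ≤ 1 / (2 * k) * (k - (2 - k)) := by
        gcongr
        exact hX.le_sum_cyc hodd
    _ = 1 - 1 / k := by
        field_simp
        ring
end

section
/- Let G = (V,E) be a finite graph equipped with a probability distribution over its edges, let k be an odd integer, and suppose there exists a probability distribution 𝒞 over odd cycles (v₁,…,v_k) of length k in G (each consecutive pair, cyclically, being an edge of G) such that the distribution obtained by sampling a cycle from 𝒞 and then a uniformly random edge of that cycle has total variation distance at most ε from the edge distribution of G. Then sdp₃(G) ≤ 1 − 1/k + ε. -/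
open Finset

namespace Sdp3Feasible

variable {V : Type} [Fintype V] {X : Matrix V V ℝ}

theorem apply_comm (hX : Sdp3Feasible X) (i j : V) : X i j = X j i := by
  simpa using hX.1.isHermitian.apply j i

theorem abs_apply_le_one (hX : Sdp3Feasible X) (i j : V) : |X i j| ≤ 1 := by
  have h₁ := hX.2.2.1 i j i
  have h₂ := hX.2.2.2 i j i
  rw [hX.2.1 i, hX.apply_comm j i] at h₁ h₂
  exact abs_le.mpr ⟨by linarith, by linarith⟩

/-- Along a walk of odd length, antipodal `ℓ₂²` distances satisfy the triangle inequality. -/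
theorem apply_sub_le_sum_walk (hX : Sdp3Feasible X) (v : ℕ → V) (m : ℕ) :
    X (v 0) (v (2 * m + 1)) - 2 * m ≤ ∑ t ∈ range (2 * m + 1), X (v t) (v (t + 1)) := by
  induction m with
  | zero => simp
  | succ m ih =>
    rw [show 2 * (m + 1) + 1 = 2 * m + 1 + 1 + 1 by ring, sum_range_succ, sum_range_succ]
    have h₁ := hX.2.2.2 (v (2 * m + 1)) (v (2 * m + 1 + 1)) (v (2 * m + 1 + 1 + 1))
    have h₂ := hX.2.2.1 (v 0) (v (2 * m + 1 + 1 + 1)) (v (2 * m + 1))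
    rw [hX.apply_comm (v (2 * m + 1 + 1 + 1)) (v (2 * m + 1))] at h₂
    push_cast
    linarith

theorem two_sub_le_sum_odd_cycle (hX : Sdp3Feasible X) {k : ℕ} (hk : Odd k) (c : Fin k → V) :
    2 - (k : ℝ) ≤ ∑ t, X (c t) (c (cyc k t)) := by
  obtain ⟨m, rfl⟩ := hk
  have h := hX.apply_sub_le_sum_walk
    (fun t => c ⟨t % (2 * m + 1), Nat.mod_lt _ (Nat.succ_pos _)⟩) m
  rw [sum_range] at h
  simp only [Nat.mod_self, Nat.zero_mod, hX.2.1] at h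
  refine (by push_cast; linarith : _ ≤ _).trans (h.trans_eq (sum_congr rfl fun t _ => ?_))
  congr 2
  exact Fin.ext (Nat.mod_eq_of_lt t.isLt)

end Sdp3Feasible

/-- Summing a symmetric function against the edge multiplicities of a loopless closed walk
counts every step of the walk twice. -/
theorem sum_card_steps_mul {V : Type} [Fintype V] [DecidableEq V] {k : ℕ} (c : Fin k → V)
    (hc : ∀ t, c t ≠ c (cyc k t)) (g : V → V → ℝ) (hg : ∀ i j, g i j = g j i) :
    ∑ i, ∑ j, ((univ.filter fun t : Fin k =>
        (c t = i ∧ c (cyc k t) = j) ∨ (c t = j ∧ c (cyc k t) = i)).card : ℝ) * g i j =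
      2 * ∑ t, g (c t) (c (cyc k t)) := by
  have hsplit (i j : V) : ((univ.filter fun t : Fin k =>
        (c t = i ∧ c (cyc k t) = j) ∨ (c t = j ∧ c (cyc k t) = i)).card : ℝ) * g i j =
      ∑ t, ((if c t = i then if c (cyc k t) = j then g i j else 0 else 0) +
        (if c (cyc k t) = i then if c t = j then g i j else 0 else 0)) := by
    rw [card_filter, Nat.cast_sum, sum_mul]
    refine sum_congr rfl fun t _ => ?_
    have := hc t
    by_cases h₁ : c t = i <;> by_cases h₂ : c (cyc k t) = j <;>
      by_cases h₃ : c t = j <;> by_cases h₄ : c (cyc k t) = i <;> simp_all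
  simp_rw [hsplit]
  rw [sum_congr rfl fun i _ => sum_comm, sum_comm, mul_sum]
  refine sum_congr rfl fun t _ => ?_
  simp only [sum_add_distrib]
  rw [sum_eq_single (c t) (by intro b _ hb; simp [hb.symm]) (by simp),
    sum_eq_single (c (cyc k t)) (by intro b _ hb; simp [hb.symm]) (by simp)]
  simp [hg (c (cyc k t)) (c t), two_mul]

/-- **Covering by odd cycles bounds `sdp₃`.** Let `G` be a finite graph with edge
distribution `p` (symmetric, supported on edges of `G`, total mass `1`), let `k` be odd,
and let `𝒞` be a probability distribution over odd closed cycles `(v₁,…,v_k)` of length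
`k` in `G` such that the distribution obtained by sampling a cycle from `𝒞` and then a
uniformly random edge of that cycle is within total variation distance `ε` of `p`.
Then `sdp₃(G) ≤ 1 − 1/k + ε`. -/
theorem odd_cycle_cover_sdp3 (n k : ℕ) (hodd : Odd k) (ε : ℝ)
    (G : SimpleGraph (Fin n))
    (p : Fin n → Fin n → ℝ)
    (hp_symm : ∀ i j, p i j = p j i)
    (hp_nonneg : ∀ i j, 0 ≤ p i j)
    (hp_supp : ∀ i j, p i j ≠ 0 → G.Adj i j)
    (hp_sum : ∑ i, ∑ j, p i j = 1)
    (𝒞 : (Fin k → Fin n) → ℝ)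
    (h𝒞_nonneg : ∀ c, 0 ≤ 𝒞 c)
    (h𝒞_sum : ∑ c, 𝒞 c = 1)
    (h𝒞_cycle : ∀ c, 𝒞 c ≠ 0 → ∀ t, G.Adj (c t) (c (cyc k t)))
    (hTV : (∑ i, ∑ j,
        |p i j - ∑ c, 𝒞 c *
            (((univ.filter fun t : Fin k =>
                (c t = i ∧ c (cyc k t) = j) ∨ (c t = j ∧ c (cyc k t) = i)).card : ℝ) /
              (2 * k))|) / 2 ≤ ε) :
    sdp3 p ≤ 1 - 1 / k + ε := by
  have hk : (1 : ℝ) ≤ k := by exact_mod_cast hodd.pos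
  set q : Fin n → Fin n → ℝ := fun i j => ∑ c, 𝒞 c *
    (((univ.filter fun t : Fin k =>
      (c t = i ∧ c (cyc k t) = j) ∨ (c t = j ∧ c (cyc k t) = i)).card : ℝ) / (2 * k)) with hq
  change (∑ i, ∑ j, |p i j - q i j|) / 2 ≤ ε at hTV
  have hε : 0 ≤ ε := le_trans (by positivity) hTV
  have hk_inv : 1 / (k : ℝ) ≤ 1 := (div_le_one (by linarith)).mpr hk
  refine Real.sSup_le ?_ (by linarith)
  rintro _ ⟨X, hX : Sdp3Feasible X, rfl⟩
  have hvalue : ∑ i, ∑ j, p i j * ((X i i + X j j - 2 * X i j) / 4) =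
      1 / 2 + (∑ i, ∑ j, (p i j - q i j) * (-X i j)) / 2 - (∑ i, ∑ j, q i j * X i j) / 2 := by
    rw [← hp_sum]
    simp only [sum_div, ← sum_add_distrib, ← sum_sub_distrib, hX.2.1]
    exact sum_congr rfl fun i _ => sum_congr rfl fun j _ => by ring
  have hdiff : ∑ i, ∑ j, (p i j - q i j) * (-X i j) ≤ ∑ i, ∑ j, |p i j - q i j| := by
    refine sum_le_sum fun i _ => sum_le_sum fun j _ => (le_abs_self _).trans ?_
    rw [abs_mul, abs_neg]
    exact mul_le_of_le_one_right (abs_nonneg _) (hX.abs_apply_le_one i j)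
  have hcover : ∑ i, ∑ j, q i j * X i j = ∑ c, 𝒞 c * ((∑ t, X (c t) (c (cyc k t))) / k) := by
    simp only [hq, sum_mul]
    rw [sum_congr rfl fun i _ => sum_comm, sum_comm]
    refine sum_congr rfl fun c _ => ?_
    by_cases hc : 𝒞 c = 0
    · simp [hc]
    have h := sum_card_steps_mul c (fun t => (h𝒞_cycle c hc t).ne) X hX.apply_comm
    rw [show (∑ t, X (c t) (c (cyc k t))) / k = (2 * ∑ t, X (c t) (c (cyc k t))) / (2 * k) by
      field_simp, ← h]
    simp only [sum_div, mul_sum]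
    exact sum_congr rfl fun i _ => sum_congr rfl fun j _ => by ring
  have hcycle : (2 - k) / (k : ℝ) ≤ ∑ i, ∑ j, q i j * X i j := by
    rw [hcover, ← one_mul ((2 - k) / (k : ℝ)), ← h𝒞_sum, sum_mul]
    gcongr with c
    · exact h𝒞_nonneg c
    · exact hX.two_sub_le_sum_odd_cycle hodd c
  have hratio : (2 - k) / (k : ℝ) = 2 * (1 / k) - 1 := by field_simp
  change ∑ i, ∑ j, p i j * ((X i i + X j j - 2 * X i j) / 4) ≤ _
  linarith
end

section
/- There is an absolute constant C such that for every γ ∈ (0, 1/2), every l ∈ [1−γ, 1−γ/2], and every dimension d ≥ 3, there exist an odd integer k ≤ C/√γ and unit vectors v₁, …, v_k on the sphere S^{d−1} ⊆ ℝ^d such that ¼‖v_i − v_{i+1}‖² = l for every i, where indices are taken cyclically (v_{k+1} = v₁). -/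
/-- The vector `(x, y, z, 0, …, 0)` of `ℝ^(n+3)`. -/
noncomputable def vecOfThree (n : ℕ) (x y z : ℝ) : EuclideanSpace ℝ (Fin (n + 3)) :=
  WithLp.toLp 2 (Fin.cons x (Fin.cons y (Fin.cons z (fun _ : Fin n => 0))))

theorem norm_vecOfThree_sq (n : ℕ) (x y z : ℝ) :
    ‖vecOfThree n x y z‖ ^ 2 = x ^ 2 + y ^ 2 + z ^ 2 := by
  rw [EuclideanSpace.norm_sq_eq]
  simp only [vecOfThree, Fin.sum_univ_succ, Fin.cons_zero, Fin.cons_succ]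
  simp
  ring

theorem vecOfThree_sub (n : ℕ) (x y z x' y' z' : ℝ) :
    vecOfThree n x y z - vecOfThree n x' y' z' = vecOfThree n (x - x') (y - y') (z - z') := by
  ext i
  refine Fin.cases ?_ (fun i => Fin.cases ?_ (fun i => Fin.cases ?_ (fun i => ?_) i) i) i <;>
    simp only [vecOfThree, PiLp.sub_apply, Fin.cons_zero, Fin.cons_succ, sub_self]

/-- A star polygon with `2m+1` vertices and half step angle `π/2 - a`, inscribed in a circle of
latitude of radius `r`, is a closed cycle on the sphere. -/
theorem exists_star_polygon (n m : ℕ) {r a : ℝ} (hr : r ^ 2 ≤ 1)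
    (ha : (2 * m + 1) * (2 * a) = Real.pi) :
    ∃ v : Fin (2 * m + 1) → EuclideanSpace ℝ (Fin (n + 3)),
      (∀ i, ‖v i‖ = 1) ∧
        ∀ i, ‖v i - v (cyc (2 * m + 1) i)‖ ^ 2 / 4 = r ^ 2 * Real.cos a ^ 2 := by
  set θ : ℝ := Real.pi - 2 * a with hθ
  refine ⟨fun i => vecOfThree n (r * Real.cos ((i : ℕ) * θ)) (r * Real.sin ((i : ℕ) * θ))
    (Real.sqrt (1 - r ^ 2)), fun i => ?_, fun i => ?_⟩
  · rw [← sq_eq_sq₀ (norm_nonneg _) zero_le_one, norm_vecOfThree_sq,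
      Real.sq_sqrt (by linarith)]
    linear_combination r ^ 2 * Real.sin_sq_add_cos_sq ((i : ℕ) * θ)
  · obtain ⟨q, hq⟩ : ∃ q : ℕ,
        ((cyc (2 * m + 1) i : ℕ) : ℝ) * θ = (i * θ + θ) - (q : ℕ) * (2 * Real.pi) := by
      refine ⟨(((i : ℕ) + 1) / (2 * m + 1)) * m, ?_⟩
      have h : ((((i : ℕ) + 1) % (2 * m + 1) : ℕ) : ℝ)
          + (2 * m + 1) * ((((i : ℕ) + 1) / (2 * m + 1) : ℕ) : ℝ) = i + 1 := by
        exact_mod_cast Nat.mod_add_div ((i : ℕ) + 1) (2 * m + 1)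
      simp only [cyc]
      push_cast
      linear_combination θ * h
        + ((((i : ℕ) + 1) / (2 * m + 1) : ℕ) : ℝ) * (ha - (2 * m + 1) * hθ)
    simp only [vecOfThree_sub, norm_vecOfThree_sq, hq, Real.cos_sub_nat_mul_two_pi,
      Real.sin_sub_nat_mul_two_pi]
    have hcos : Real.cos θ = 1 - 2 * Real.cos a ^ 2 := by
      rw [hθ, Real.cos_pi_sub, Real.cos_two_mul]; ring
    have hprod : Real.cos (i * θ) * Real.cos (i * θ + θ)
        + Real.sin (i * θ) * Real.sin (i * θ + θ) = Real.cos θ := by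
      rw [← Real.cos_sub, ← Real.cos_neg]; congr 1; ring
    linear_combination r ^ 2 / 4 * (Real.sin_sq_add_cos_sq (i * θ)
      + Real.sin_sq_add_cos_sq (i * θ + θ) - 2 * hprod - 2 * hcos)

/-- **Short odd cycles of prescribed edge length on the sphere.** There is an absolute
constant `C` such that for every `γ ∈ (0, 1/2)`, every `l ∈ [1−γ, 1−γ/2]`, and every
dimension `d ≥ 3`, there exist an odd integer `k ≤ C/√γ` and unit vectors
`v₁, …, v_k ∈ S^{d−1} ⊆ ℝ^d` forming a closed cycle with `¼‖v_i − v_{i+1}‖² = l` for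
every `i` (indices cyclic). -/
theorem odd_cycle_on_sphere :
    ∃ C : ℝ, 0 < C ∧
      ∀ γ : ℝ, 0 < γ → γ < 1 / 2 →
        ∀ l : ℝ, 1 - γ ≤ l → l ≤ 1 - γ / 2 →
          ∀ d : ℕ, 3 ≤ d →
            ∃ k : ℕ, Odd k ∧ (k : ℝ) ≤ C / Real.sqrt γ ∧
              ∃ v : Fin k → EuclideanSpace ℝ (Fin d),
                (∀ i, ‖v i‖ = 1) ∧ ∀ i, ‖v i - v (cyc k i)‖ ^ 2 / 4 = l := by
  refine ⟨7, by norm_num, fun γ hγ hγ2 l hl hl' d hd => ?_⟩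
  obtain ⟨n, rfl⟩ := Nat.exists_eq_add_of_le' hd
  have hs : 0 < Real.sqrt γ := Real.sqrt_pos.2 hγ
  have hs1 : Real.sqrt γ ≤ 1 := Real.sqrt_le_one.2 (by linarith)
  set m := ⌈2 / Real.sqrt γ⌉₊
  have hm : 2 / Real.sqrt γ ≤ m := Nat.le_ceil _
  have hm' : (m : ℝ) < 2 / Real.sqrt γ + 1 := Nat.ceil_lt_add_one (by positivity)
  set a : ℝ := Real.pi / (2 * (2 * m + 1)) with ha
  have ha0 : 0 < a := by positivity
  have ha_le : a ≤ Real.sqrt γ / 2 := by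
    rw [div_le_iff₀ hs] at hm
    rw [ha, div_le_iff₀ (by positivity)]
    nlinarith [Real.pi_le_four]
  have hcos : l ≤ Real.cos a ^ 2 := by
    have hsin : Real.sin a ^ 2 ≤ a ^ 2 := Real.sin_sq_le_sq
    nlinarith [Real.sin_sq_add_cos_sq a, Real.sq_sqrt hγ.le]
  have hl0 : 0 < l := by linarith
  have hcos0 : 0 < Real.cos a ^ 2 := hl0.trans_le hcos
  have hr : Real.sqrt (l / Real.cos a ^ 2) ^ 2 = l / Real.cos a ^ 2 :=
    Real.sq_sqrt (by positivity)
  obtain ⟨v, hv, hedge⟩ := exists_star_polygon n m (r := Real.sqrt (l / Real.cos a ^ 2)) (a := a)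
    (by rw [hr]; exact (div_le_one hcos0).2 hcos) (by rw [ha]; field_simp)
  refine ⟨2 * m + 1, odd_two_mul_add_one m, ?_, v, hv, fun i => ?_⟩
  · have h1 : 1 ≤ 1 / Real.sqrt γ := (one_le_div hs).2 hs1
    have h2 : 2 / Real.sqrt γ = 2 * (1 / Real.sqrt γ) := by ring
    have h7 : 7 / Real.sqrt γ = 7 * (1 / Real.sqrt γ) := by ring
    push_cast
    linarith
  · rw [hedge, hr, div_mul_cancel₀ _ hcos0.ne']
end

section
/- There is an absolute constant c > 0 such that for every γ ∈ (0,1) there exists d₀ ∈ ℕ with the following property: for every d ≥ d₀, the continuous sphere graph G_γ on S^{d−1} satisfies sdp₃(G_γ) ≤ 1 − c·√γ. -/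
open MeasureTheory RealInnerProductSpace

/-- The uniform probability measure on the unit sphere `S^{d-1} ⊆ ℝ^d` (the normalized
surface measure). -/
noncomputable def sphereUniform (d : ℕ) :
    Measure (Metric.sphere (0 : EuclideanSpace ℝ (Fin d)) 1) :=
  (((volume : Measure (EuclideanSpace ℝ (Fin d))).toSphere Set.univ)⁻¹) •
    (volume : Measure (EuclideanSpace ℝ (Fin d))).toSphere

/-- The edge distribution of the sphere graph `G_γ`: a pair of independent uniform random
points of `S^{d-1}` conditioned on `¼‖u − v‖² ≥ 1 − γ`. -/
noncomputable def sphereEdgeMeasure (d : ℕ) (γ : ℝ) :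
    Measure (Metric.sphere (0 : EuclideanSpace ℝ (Fin d)) 1 ×
      Metric.sphere (0 : EuclideanSpace ℝ (Fin d)) 1) :=
  ProbabilityTheory.cond ((sphereUniform d).prod (sphereUniform d))
    {p | 1 - γ ≤ ‖(p.1 : EuclideanSpace ℝ (Fin d)) - (p.2 : EuclideanSpace ℝ (Fin d))‖ ^ 2 / 4}

section Sphere

open Metric

variable {V : Type*} [NormedAddCommGroup V] [InnerProductSpace ℝ V]

/-- The action of a linear isometry on the unit sphere. -/
def sphereRot (S : V ≃ₗᵢ[ℝ] V) (x : sphere (0 : V) 1) : sphere (0 : V) 1 :=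
  ⟨S x, by simp⟩

@[simp]
theorem coe_sphereRot (S : V ≃ₗᵢ[ℝ] V) (x : sphere (0 : V) 1) : (sphereRot S x : V) = S x := rfl

theorem continuous_sphereRot (S : V ≃ₗᵢ[ℝ] V) : Continuous (sphereRot S) :=
  (S.continuous.comp continuous_subtype_val).subtype_mk _

theorem measurePreserving_sphereRot_toSphere [FiniteDimensional ℝ V] [MeasurableSpace V]
    [BorelSpace V] (S : V ≃ₗᵢ[ℝ] V) :
    MeasurePreserving (sphereRot S) (volume : Measure V).toSphere
      (volume : Measure V).toSphere := by
  refine ⟨(continuous_sphereRot S).measurable, ?_⟩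
  ext s hs
  rw [Measure.map_apply (continuous_sphereRot S).measurable hs, Measure.toSphere_apply' _ hs,
    Measure.toSphere_apply' _ ((continuous_sphereRot S).measurable hs)]
  congr 1
  refine Eq.trans ?_ (S.measurePreserving.measure_preimage_equiv (f := S.toMeasurableEquiv) _)
  congr 1
  ext x
  simp only [Set.mem_smul, Set.mem_image, Set.mem_preimage, Subtype.exists]
  constructor
  · rintro ⟨r, hr, _, ⟨y, hy, hys, rfl⟩, rfl⟩
    exact ⟨r, hr, S y, ⟨S y, by simpa using hy, hys, rfl⟩, by simp⟩
  · rintro ⟨r, hr, _, ⟨y, hy, hys, rfl⟩, hx⟩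
    refine ⟨r, hr, S.symm y, ⟨S.symm y, by simpa using hy, by simpa [sphereRot] using hys, rfl⟩, ?_⟩
    rw [← map_smul, hx]
    simp

theorem exists_isometry_map_pair {x y x' y' : V} (hx : ‖x‖ = ‖x'‖) (hy : ‖y‖ = ‖y'‖)
    (h : ⟪x, y⟫ = ⟪x', y'⟫) : ∃ S : V ≃ₗᵢ[ℝ] V, S x = x' ∧ S y = y' := by
  let S₁ := (ℝ ∙ (x - x'))ᗮ.reflection
  have h₁ : S₁ x = x' := Submodule.reflection_sub hx
  let S₂ := (ℝ ∙ (S₁ y - y'))ᗮ.reflection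
  have h₂ : S₂ (S₁ y) = y' := Submodule.reflection_sub (by simpa using hy)
  have h₃ : S₂ x' = x' := by
    apply Submodule.reflection_mem_subspace_eq_self
    rw [Submodule.mem_orthogonal_singleton_iff_inner_left, inner_sub_right, ← h, ← h₁,
      S₁.inner_map_map, sub_self]
  exact ⟨S₁.trans S₂, by simp [h₁, h₃], by simp [h₂]⟩

instance compactSpace_unitary [FiniteDimensional ℝ V] :
    CompactSpace (unitary (V →L[ℝ] V)) := by
  refine isCompact_iff_compactSpace.1 (?_ : IsCompact (unitary (V →L[ℝ] V) : Set (V →L[ℝ] V)))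
  have : ProperSpace (V →L[ℝ] V) := FiniteDimensional.proper ℝ _
  refine Metric.isCompact_of_isClosed_isBounded isClosed_unitary ?_
  refine (Metric.isBounded_closedBall (x := (0 : V →L[ℝ] V)) (r := 1)).subset fun u hu => ?_
  rw [mem_closedBall_zero_iff]
  refine ContinuousLinearMap.opNorm_le_bound _ zero_le_one fun x => ?_
  rw [Unitary.norm_map ⟨u, hu⟩ x, one_mul]

/-- If every pair in `C` can be continued to a `k`-step walk with constant inner product along
every rotation of which `G` sums to at least `1`, then `G` has integral at least `1 / k` times the
measure of `C`. -/
theorem measure_le_mul_lintegral_of_walk [FiniteDimensional ℝ V] [MeasurableSpace V] [BorelSpace V]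
    (μ : Measure (sphere (0 : V) 1)) [IsFiniteMeasure μ]
    (hμ : ∀ S : V ≃ₗᵢ[ℝ] V, MeasurePreserving (sphereRot S) μ μ)
    {G : sphere (0 : V) 1 × sphere (0 : V) 1 → ENNReal} (hG : Measurable G) (k : ℕ)
    {C : Set (sphere (0 : V) 1 × sphere (0 : V) 1)} (hC : MeasurableSet C)
    (hwalk : ∀ p ∈ C, ∃ x : ℕ → sphere (0 : V) 1,
      (∀ i, ⟪(x i : V), (x (i + 1) : V)⟫ = ⟪(p.1 : V), (p.2 : V)⟫) ∧
      ∀ S : V ≃ₗᵢ[ℝ] V,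
        1 ≤ ∑ i ∈ Finset.range k, G (sphereRot S (x i), sphereRot S (x (i + 1)))) :
    (μ.prod μ) C ≤ k * ∫⁻ p, G p ∂(μ.prod μ) := by
  borelize ↥(unitary (V →L[ℝ] V))
  have : SecondCountableTopology (V →L[ℝ] V) := secondCountable_of_proper
  let κ : Measure (unitary (V →L[ℝ] V)) := Measure.haarMeasure ⊤
  have hκ : IsProbabilityMeasure κ := ⟨Measure.haarMeasure_self (K₀ := ⊤)⟩
  let ρ : unitary (V →L[ℝ] V) → (V ≃ₗᵢ[ℝ] V) := fun R => Unitary.linearIsometryEquiv R⁻¹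
  let act : unitary (V →L[ℝ] V) × (sphere (0 : V) 1 × sphere (0 : V) 1) →
      sphere (0 : V) 1 × sphere (0 : V) 1 := fun q =>
    (sphereRot (ρ q.1) q.2.1, sphereRot (ρ q.1) q.2.2)
  have hact : Measurable act := by
    have h₁ : Continuous fun q : unitary (V →L[ℝ] V) × sphere (0 : V) 1 =>
        sphereRot (ρ q.1) q.2 := by
      refine Continuous.subtype_mk ?_ _
      change Continuous fun q : unitary (V →L[ℝ] V) × sphere (0 : V) 1 =>
        ((q.1⁻¹ : unitary (V →L[ℝ] V)) : V →L[ℝ] V) (q.2 : V)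
      exact (continuous_subtype_val.comp continuous_fst.inv).clm_apply
        (continuous_subtype_val.comp continuous_snd)
    exact ((h₁.comp (continuous_fst.prodMk (continuous_fst.comp continuous_snd))).prodMk
      (h₁.comp (continuous_fst.prodMk (continuous_snd.comp continuous_snd)))).measurable
  let avg : sphere (0 : V) 1 × sphere (0 : V) 1 → ENNReal := fun p => ∫⁻ R, G (act (R, p)) ∂κ
  have havg_eq : ∀ p q : sphere (0 : V) 1 × sphere (0 : V) 1,
      ⟪(p.1 : V), (p.2 : V)⟫ = ⟪(q.1 : V), (q.2 : V)⟫ → avg p = avg q := by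
    intro p q hpq
    obtain ⟨S, h₁, h₂⟩ := exists_isometry_map_pair (by simp) (by simp) hpq
    let s : unitary (V →L[ℝ] V) := Unitary.linearIsometryEquiv.symm S
    have key : ∀ R, act (s * R, q) = act (R, p) := by
      intro R
      have hρ : ∀ x, ρ (s * R) (S x) = ρ R x := by
        intro x
        simp only [ρ, s, mul_inv_rev, map_mul, map_inv, MulEquiv.apply_symm_apply]
        exact congrArg (Unitary.linearIsometryEquiv R).symm (S.symm_apply_apply x)
      refine Prod.ext (Subtype.ext ?_) (Subtype.ext ?_)
      · change ρ (s * R) (q.1 : V) = ρ R (p.1 : V)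
        rw [← h₁, hρ]
      · change ρ (s * R) (q.2 : V) = ρ R (p.2 : V)
        rw [← h₂, hρ]
    calc avg p = ∫⁻ R, G (act (s * R, q)) ∂κ := by simp only [key]; rfl
      _ = avg q := lintegral_mul_left_eq_self (μ := κ) (fun R => G (act (R, q))) s
  have havg_int : ∫⁻ p, avg p ∂(μ.prod μ) = ∫⁻ p, G p ∂(μ.prod μ) := by
    rw [lintegral_lintegral_swap (f := fun p R => G (act (R, p)))
      (hG.comp (hact.comp measurable_swap)).aemeasurable]
    have : ∀ R, ∫⁻ p, G (act (R, p)) ∂(μ.prod μ) = ∫⁻ p, G p ∂(μ.prod μ) := fun R =>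
      ((hμ (ρ R)).prod (hμ (ρ R))).lintegral_comp hG
    simp [this]
  have hle : ∀ p ∈ C, 1 ≤ k * avg p := by
    intro p hp
    obtain ⟨x, hx, hsum⟩ := hwalk p hp
    calc (1 : ENNReal) = ∫⁻ _, 1 ∂κ := by simp
      _ ≤ ∫⁻ R, ∑ i ∈ Finset.range k, G (act (R, (x i, x (i + 1)))) ∂κ :=
        lintegral_mono fun R => hsum (ρ R)
      _ = ∑ i ∈ Finset.range k, avg (x i, x (i + 1)) :=
        lintegral_finsetSum _ fun i _ => hG.comp (hact.comp measurable_prodMk_right)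
      _ = k * avg p := by
        rw [Finset.sum_congr rfl fun i _ => havg_eq (x i, x (i + 1)) p (hx i)]
        simp
  calc (μ.prod μ) C = ∫⁻ _ in C, 1 ∂(μ.prod μ) := by simp
    _ ≤ ∫⁻ p in C, k * avg p ∂(μ.prod μ) := setLIntegral_mono' hC hle
    _ ≤ ∫⁻ p, k * avg p ∂(μ.prod μ) := setLIntegral_le_lintegral _ _
    _ = k * ∫⁻ p, G p ∂(μ.prod μ) := by
      rw [lintegral_const_mul' _ _ (by simp), havg_int]

/-- A closed walk of odd length `k` on a circle of the sphere with constant inner product `t`. -/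
theorem exists_closed_walk {e : Fin 3 → V} (he : Orthonormal ℝ e) {k : ℕ} (hk : Odd k)
    (hk2 : 2 ≤ k) {t : ℝ}
    (ht : -Real.cos (Real.pi / k) ≤ t) (ht1 : t ≤ 1) :
    ∃ x : ℕ → sphere (0 : V) 1, x k = x 0 ∧ ∀ i, ⟪(x i : V), (x (i + 1) : V)⟫ = t := by
  have hk0 : (2 : ℝ) ≤ k := by exact_mod_cast hk2
  have hc : 0 ≤ Real.cos (Real.pi / k) := by
    refine Real.cos_nonneg_of_neg_pi_div_two_le_of_le ?_ ?_
    · have := Real.pi_pos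
      have : 0 ≤ Real.pi / k := by positivity
      linarith
    · gcongr
  let c := Real.cos (Real.pi / k)
  let α := Real.pi - Real.pi / k
  let w := (1 - t) / (1 + c)
  have hw0 : 0 ≤ w := div_nonneg (by linarith) (by positivity)
  have hw1 : w ≤ 1 := by
    rw [div_le_one (by positivity)]
    linarith
  have hα : Real.cos α = -c := Real.cos_pi_sub _
  have hinner : ∀ a b z a' b' z' : ℝ,
      ⟪a • e 0 + b • e 1 + z • e 2, a' • e 0 + b' • e 1 + z' • e 2⟫ = a * a' + b * b' + z * z' := by
    intro a b z a' b' z'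
    have h := he.inner_sum ![a, b, z] ![a', b', z'] Finset.univ
    simpa [Fin.sum_univ_three, mul_comm] using h
  let y : ℕ → V := fun i => (√w * Real.cos (i * α)) • e 0 + (√w * Real.sin (i * α)) • e 1 +
    √(1 - w) • e 2
  have hsq := Real.mul_self_sqrt hw0
  have hsq' := Real.mul_self_sqrt (sub_nonneg.2 hw1)
  have hy : ∀ i, ‖y i‖ = 1 := by
    intro i
    rw [← sq_eq_sq₀ (norm_nonneg _) zero_le_one, ← real_inner_self_eq_norm_sq, hinner]
    linear_combination (Real.cos (i * α) ^ 2 + Real.sin (i * α) ^ 2) * hsq + hsq' +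
      w * Real.sin_sq_add_cos_sq (i * α)
  refine ⟨fun i => ⟨y i, by simpa using hy i⟩, ?_, ?_⟩
  · obtain ⟨m, hm⟩ := hk
    have hkα : (k : ℝ) * α = m * (2 * Real.pi) := by
      have : (k : ℝ) = 2 * m + 1 := by exact_mod_cast hm
      have hne : (k : ℝ) ≠ 0 := by positivity
      simp only [α]
      field_simp
      rw [this]
      ring
    have hsin : Real.sin (m * (2 * Real.pi)) = 0 := by
      simpa [mul_assoc, mul_left_comm] using Real.sin_nat_mul_pi (2 * m)
    ext1
    simp [y, hkα, Real.cos_nat_mul_two_pi, hsin]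
  · intro i
    have hcos : Real.cos (i * α) * Real.cos ((i + 1 : ℕ) * α) +
        Real.sin (i * α) * Real.sin ((i + 1 : ℕ) * α) = -c := by
      rw [← Real.cos_sub, ← hα, ← Real.cos_neg]
      congr 1
      push_cast
      ring
    have hwc : w * (1 + c) = 1 - t := div_mul_cancel₀ _ (by positivity)
    change ⟪y i, y (i + 1)⟫ = t
    rw [hinner]
    linear_combination (Real.cos (i * α) * Real.cos ((i + 1 : ℕ) * α) +
        Real.sin (i * α) * Real.sin ((i + 1 : ℕ) * α)) * hsq + hsq' + w * hcos - hwc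


theorem exists_orthogonal_unit {e : Fin 3 → V} (he : Orthonormal ℝ e) (x : sphere (0 : V) 1) :
    ∃ f : V, ‖f‖ = 1 ∧ ⟪(x : V), f⟫ = 0 := by
  obtain ⟨S, hS, -⟩ := exists_isometry_map_pair (x := e 0) (y := e 0) (x' := (x : V)) (y' := x)
    (by simp [he.1]) (by simp [he.1]) (by simp [he.1])
  refine ⟨S (e 1), by simp [he.1], ?_⟩
  rw [← hS, S.inner_map_map]
  exact he.2 (by decide)

/-- A spherical cap has at least twice the measure of a cap of a quarter of its chordal radius. -/
theorem two_mul_measure_small_cap_le [MeasurableSpace V] [BorelSpace V]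
    (μ : Measure (sphere (0 : V) 1))
    (hμ : ∀ S : V ≃ₗᵢ[ℝ] V, MeasurePreserving (sphereRot S) μ μ)
    {e : Fin 3 → V} (he : Orthonormal ℝ e) {γ : ℝ} (hγ : 0 < γ) (hγ1 : γ < 1)
    (x : sphere (0 : V) 1) :
    2 * μ {y | ‖(x : V) + y‖ < √γ / 2} ≤ μ {y | ‖(x : V) + y‖ ≤ 2 * √γ} := by
  obtain ⟨f, hf, hxf⟩ := exists_orthogonal_unit he x
  have hx : ‖(x : V)‖ = 1 := by simp
  have hs := Real.sq_sqrt hγ.le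
  have hr := Real.sq_sqrt (show 0 ≤ 1 - γ / 4 by linarith)
  have hspos := Real.sqrt_pos.2 hγ
  have hnorm : ∀ a b : ℝ, ‖a • (x : V) + b • f‖ ^ 2 = a ^ 2 + b ^ 2 := by
    intro a b
    rw [norm_add_sq_real, inner_smul_left, inner_smul_right, hxf, norm_smul, norm_smul, hx, hf]
    simp
  let b := √γ * √(1 - γ / 4)
  have hb : b ^ 2 = γ * (1 - γ / 4) := by rw [mul_pow, hs, hr]
  have hunit : ∀ σ : ℝ, σ ^ 2 = 1 → ‖(1 - γ / 2) • (x : V) + (σ * b) • f‖ = 1 := by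
    intro σ hσ
    rw [← sq_eq_sq₀ (norm_nonneg _) zero_le_one, hnorm]
    linear_combination b ^ 2 * hσ + hb
  have hclose : ∀ σ : ℝ, σ ^ 2 = 1 → ‖(x : V) - ((1 - γ / 2) • (x : V) + (σ * b) • f)‖ = √γ := by
    intro σ hσ
    rw [← sq_eq_sq₀ (norm_nonneg _) hspos.le, hs]
    have : (x : V) - ((1 - γ / 2) • (x : V) + (σ * b) • f) = (γ / 2) • (x : V) + (-(σ * b)) • f := by
      module
    rw [this, hnorm]
    linear_combination b ^ 2 * hσ + hb
  let cap : V → Set (sphere (0 : V) 1) := fun p => {y | ‖p + y‖ < √γ / 2}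
  have hopen : ∀ p, IsOpen (cap p) := fun p =>
    isOpen_lt ((continuous_const.add continuous_subtype_val).norm) continuous_const
  have hcap : ∀ p : V, ‖p‖ = 1 → μ (cap p) = μ (cap x) := by
    intro p hp
    obtain ⟨S, hS, -⟩ := exists_isometry_map_pair (x := (x : V)) (y := x) (x' := p) (y' := p)
      (by simp [hp]) (by simp [hp]) (by simp [hp])
    rw [← (hμ S).measure_preimage (hopen p).measurableSet.nullMeasurableSet]
    congr 1
    ext y
    simp only [cap, Set.mem_preimage, Set.mem_ofPred_eq, coe_sphereRot, ← hS, ← map_add,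
      LinearIsometryEquiv.norm_map]
  let p : ℝ → V := fun σ => (1 - γ / 2) • (x : V) + (σ * b) • f
  have hsub : ∀ σ : ℝ, σ ^ 2 = 1 → cap (p σ) ⊆ {y | ‖(x : V) + y‖ ≤ 2 * √γ} := by
    intro σ hσ y hy
    have h₁ : ‖p σ + y‖ < √γ / 2 := hy
    have h₂ : ‖(x : V) - p σ‖ = √γ := hclose σ hσ
    have h₃ := norm_add_le ((x : V) - p σ) (p σ + y)
    rw [← add_assoc, sub_add_cancel] at h₃
    change ‖(x : V) + y‖ ≤ 2 * √γ
    linarith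
  have hdisj : Disjoint (cap (p 1)) (cap (p (-1))) := by
    rw [Set.disjoint_left]
    intro y h₁ h₂
    replace h₁ : ‖p 1 + y‖ < √γ / 2 := h₁
    replace h₂ : ‖p (-1) + y‖ < √γ / 2 := h₂
    have h₃ := norm_sub_le (p 1 + (y : V)) (p (-1) + y)
    have h₄ : p 1 + (y : V) - (p (-1) + y) = (0 : ℝ) • (x : V) + (2 * b) • f := by
      simp only [p]
      module
    have h₅ : ‖p 1 + (y : V) - (p (-1) + y)‖ ^ 2 = 4 * (γ * (1 - γ / 4)) := by
      rw [h₄, hnorm, ← hb]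
      ring
    nlinarith [norm_nonneg (p 1 + (y : V) - (p (-1) + y))]
  calc 2 * μ (cap x) = μ (cap (p 1)) + μ (cap (p (-1))) := by
        rw [hcap _ (hunit 1 (by norm_num)), hcap _ (hunit (-1) (by norm_num)), two_mul]
    _ = μ (cap (p 1) ∪ cap (p (-1))) := (measure_union hdisj (hopen _).measurableSet).symm
    _ ≤ _ := measure_mono (Set.union_subset (hsub 1 (by norm_num)) (hsub (-1) (by norm_num)))

end Sphere

section OddCycle

variable {X H : Type*} [NormedAddCommGroup H] [InnerProductSpace ℝ H] {f : X → H}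

/-- The odd cycle inequality implied by the triangle inequalities. -/
theorem one_le_sum_of_odd_cycle
    (h₁ : ∀ u v w, ⟪f u, f v⟫ + ⟪f v, f w⟫ - ⟪f u, f w⟫ ≤ 1)
    (h₂ : ∀ u v w, -1 ≤ ⟪f u, f v⟫ + ⟪f v, f w⟫ + ⟪f u, f w⟫)
    (hf : ∀ u, ‖f u‖ = 1) {k : ℕ} (hk : Odd k) {x : ℕ → X} (hx : x k = x 0) :
    1 ≤ ∑ i ∈ Finset.range k, (1 + ⟪f (x i), f (x (i + 1))⟫) / 2 := by
  obtain ⟨m, rfl⟩ := hk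
  have hpath : ∀ j : ℕ, (1 - ⟪f (x 0), f (x (2 * j))⟫) / 2 ≤
      ∑ i ∈ Finset.range (2 * j), (1 + ⟪f (x i), f (x (i + 1))⟫) / 2 := by
    intro j
    induction j with
    | zero => simp [hf]
    | succ j ih =>
      rw [show 2 * (j + 1) = 2 * j + 1 + 1 by ring, Finset.sum_range_succ, Finset.sum_range_succ]
      linarith [h₁ (x 0) (x (2 * j)) (x (2 * j + 1 + 1)),
        h₂ (x (2 * j)) (x (2 * j + 1)) (x (2 * j + 1 + 1))]
  rw [Finset.sum_range_succ, hx]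
  linarith [hpath m, real_inner_comm (f (x 0)) (f (x (2 * m)))]

end OddCycle


section Edge

open Metric

variable {V : Type*} [NormedAddCommGroup V] [InnerProductSpace ℝ V] [FiniteDimensional ℝ V]
  [MeasurableSpace V] [BorelSpace V]

/-- At least half of the edges of the sphere graph are not too close to being antipodal. -/
theorem measure_edge_le_two_mul (μ : Measure (sphere (0 : V) 1)) [IsFiniteMeasure μ]
    (hμ : ∀ S : V ≃ₗᵢ[ℝ] V, MeasurePreserving (sphereRot S) μ μ)
    {e : Fin 3 → V} (he : Orthonormal ℝ e) {γ : ℝ} (hγ : 0 < γ) (hγ1 : γ < 1) :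
    (μ.prod μ) {p | 1 - γ ≤ ‖(p.1 : V) - p.2‖ ^ 2 / 4} ≤
      2 * (μ.prod μ) ({p | 1 - γ ≤ ‖(p.1 : V) - p.2‖ ^ 2 / 4} ∩
        {p | γ / 8 - 1 ≤ ⟪(p.1 : V), (p.2 : V)⟫}) := by
  set A : Set (sphere (0 : V) 1 × sphere (0 : V) 1) := {p | 1 - γ ≤ ‖(p.1 : V) - p.2‖ ^ 2 / 4}
  set C : Set (sphere (0 : V) 1 × sphere (0 : V) 1) := {p | γ / 8 - 1 ≤ ⟪(p.1 : V), (p.2 : V)⟫}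
  have hA : MeasurableSet A := by
    refine (isClosed_le continuous_const ?_).measurableSet
    fun_prop
  have hC : MeasurableSet C := by
    refine (isClosed_le continuous_const ?_).measurableSet
    fun_prop
  have hadd : ∀ x y : sphere (0 : V) 1, ‖(x : V) + y‖ ^ 2 = 2 + 2 * ⟪(x : V), (y : V)⟫ := by
    intro x y
    rw [norm_add_sq_real]
    simp
    ring
  have hsub : ∀ x y : sphere (0 : V) 1, ‖(x : V) - y‖ ^ 2 = 2 - 2 * ⟪(x : V), (y : V)⟫ := by
    intro x y
    rw [norm_sub_sq_real]
    simp
    ring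
  have hs := Real.sq_sqrt hγ.le
  have hspos := Real.sqrt_pos.2 hγ
  have hsmall : 2 * (μ.prod μ) (A \ C) ≤ (μ.prod μ) A := by
    rw [Measure.prod_apply hA, Measure.prod_apply (hA.diff hC),
      ← lintegral_const_mul' _ _ (by simp)]
    refine lintegral_mono fun x => ?_
    refine le_trans ?_ ((two_mul_measure_small_cap_le μ hμ he hγ hγ1 x).trans ?_)
    · gcongr
      rintro y ⟨-, hy⟩
      replace hy : ⟪(x : V), (y : V)⟫ < γ / 8 - 1 := not_le.1 hy
      change ‖(x : V) + y‖ < √γ / 2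
      rw [← sq_lt_sq₀ (norm_nonneg _) (by positivity), hadd, div_pow, hs]
      linarith
    · refine measure_mono fun y hy => ?_
      replace hy : ‖(x : V) + y‖ ≤ 2 * √γ := hy
      rw [← sq_le_sq₀ (norm_nonneg _) (by positivity), hadd, mul_pow, hs] at hy
      change 1 - γ ≤ ‖(x : V) - y‖ ^ 2 / 4
      rw [hsub]
      linarith
  have hsplit : (μ.prod μ) (A ∩ C) + (μ.prod μ) (A \ C) = (μ.prod μ) A :=
    measure_inter_add_sdiff A hC
  have hfin : (μ.prod μ) A ≠ ⊤ := measure_ne_top _ _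
  refine (ENNReal.add_le_add_iff_right hfin).1 ?_
  calc (μ.prod μ) A + (μ.prod μ) A
      = 2 * (μ.prod μ) (A ∩ C) + 2 * (μ.prod μ) (A \ C) := by
        rw [← mul_add, hsplit, two_mul]
    _ ≤ 2 * (μ.prod μ) (A ∩ C) + (μ.prod μ) A := by gcongr

theorem measure_edge_le_mul_lintegral (μ : Measure (sphere (0 : V) 1)) [IsFiniteMeasure μ]
    (hμ : ∀ S : V ≃ₗᵢ[ℝ] V, MeasurePreserving (sphereRot S) μ μ)
    {e : Fin 3 → V} (he : Orthonormal ℝ e) {γ : ℝ} (hγ : 0 < γ) (hγ1 : γ < 1)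
    {k : ℕ} (hk : Odd k) (hk2 : 2 ≤ k) (hkγ : 1 - Real.cos (Real.pi / k) ≤ γ / 8)
    {H : Type*} [NormedAddCommGroup H] [InnerProductSpace ℝ H] {f : sphere (0 : V) 1 → H}
    (hf : ∀ u, ‖f u‖ = 1)
    (h₁ : ∀ u v w, ⟪f u, f v⟫ + ⟪f v, f w⟫ - ⟪f u, f w⟫ ≤ 1)
    (h₂ : ∀ u v w, -1 ≤ ⟪f u, f v⟫ + ⟪f v, f w⟫ + ⟪f u, f w⟫)
    (hmeas : AEMeasurable (fun p => ENNReal.ofReal ((1 + ⟪f p.1, f p.2⟫) / 2))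
      ((μ.prod μ).restrict {p | 1 - γ ≤ ‖(p.1 : V) - p.2‖ ^ 2 / 4})) :
    (μ.prod μ) {p | 1 - γ ≤ ‖(p.1 : V) - p.2‖ ^ 2 / 4} ≤
      2 * k * ∫⁻ p in {p | 1 - γ ≤ ‖(p.1 : V) - p.2‖ ^ 2 / 4},
        ENNReal.ofReal ((1 + ⟪f p.1, f p.2⟫) / 2) ∂(μ.prod μ) := by
  have hhalf := measure_edge_le_two_mul μ hμ he hγ hγ1
  set A : Set (sphere (0 : V) 1 × sphere (0 : V) 1) := {p | 1 - γ ≤ ‖(p.1 : V) - p.2‖ ^ 2 / 4}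
  set C : Set (sphere (0 : V) 1 × sphere (0 : V) 1) := {p | γ / 8 - 1 ≤ ⟪(p.1 : V), (p.2 : V)⟫}
  have hA : MeasurableSet A := by
    refine (isClosed_le continuous_const ?_).measurableSet
    fun_prop
  have hC : MeasurableSet C := by
    refine (isClosed_le continuous_const ?_).measurableSet
    fun_prop
  have hAiff : ∀ p : sphere (0 : V) 1 × sphere (0 : V) 1,
      p ∈ A ↔ ⟪(p.1 : V), (p.2 : V)⟫ ≤ 2 * γ - 1 := by
    intro p
    change 1 - γ ≤ ‖(p.1 : V) - p.2‖ ^ 2 / 4 ↔ _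
    rw [norm_sub_sq_real]
    simp only [norm_eq_of_mem_sphere]
    constructor <;> intro h <;> linarith
  set g : sphere (0 : V) 1 × sphere (0 : V) 1 → ENNReal :=
    fun p => ENNReal.ofReal ((1 + ⟪f p.1, f p.2⟫) / 2)
  -- a measurable majorant of `g` with the same integral over `A`
  let N := toMeasurable ((μ.prod μ).restrict A) {p | g p ≠ hmeas.mk g p}
  have hN : MeasurableSet N := measurableSet_toMeasurable _ _
  have hN0 : ((μ.prod μ).restrict A) N = 0 := by
    rw [measure_toMeasurable]
    exact ae_iff.1 hmeas.ae_eq_mk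
  classical
  let M : sphere (0 : V) 1 × sphere (0 : V) 1 → ENNReal := N.piecewise ⊤ (hmeas.mk g)
  have hM : Measurable M := measurable_const.piecewise hN hmeas.measurable_mk
  have hgM : ∀ p, g p ≤ M p := by
    intro p
    by_cases hp : p ∈ N
    · simp [M, hp]
    · have : g p = hmeas.mk g p := by
        by_contra hne
        exact hp (subset_toMeasurable _ _ hne)
      simp [M, hp, this]
  have hMint : ∫⁻ p, A.indicator M p ∂(μ.prod μ) = ∫⁻ p in A, g p ∂(μ.prod μ) := by
    rw [lintegral_indicator hA]
    refine lintegral_congr_ae ?_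
    filter_upwards [hmeas.ae_eq_mk, measure_eq_zero_iff_ae_notMem.1 hN0] with p hp hpN
    simp [M, hpN, hp]
  have hwalk : (μ.prod μ) (A ∩ C) ≤ k * ∫⁻ p, A.indicator M p ∂(μ.prod μ) := by
    refine measure_le_mul_lintegral_of_walk μ hμ (hM.indicator hA) k (hA.inter hC) ?_
    rintro p ⟨hpA, hpC⟩
    replace hpC : γ / 8 - 1 ≤ ⟪(p.1 : V), (p.2 : V)⟫ := hpC
    obtain ⟨x, hx, hxi⟩ := exists_closed_walk he hk hk2 (t := ⟪(p.1 : V), (p.2 : V)⟫)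
      (by linarith) (by linarith [(hAiff p).1 hpA])
    refine ⟨x, hxi, fun S => ?_⟩
    have hcycle := one_le_sum_of_odd_cycle h₁ h₂ hf hk (x := fun i => sphereRot S (x i))
      (congrArg (sphereRot S) hx)
    have hnonneg : ∀ u v, 0 ≤ (1 + ⟪f u, f v⟫) / 2 := by
      intro u v
      have := (abs_le.1 (abs_real_inner_le_norm (f u) (f v))).1
      rw [hf, hf] at this
      linarith
    calc (1 : ENNReal) = ENNReal.ofReal 1 := by simp
      _ ≤ ENNReal.ofReal (∑ i ∈ Finset.range k,
          (1 + ⟪f (sphereRot S (x i)), f (sphereRot S (x (i + 1)))⟫) / 2) :=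
        ENNReal.ofReal_le_ofReal hcycle
      _ = ∑ i ∈ Finset.range k, g (sphereRot S (x i), sphereRot S (x (i + 1))) :=
        ENNReal.ofReal_sum_of_nonneg fun i _ => hnonneg _ _
      _ ≤ _ := by
        refine Finset.sum_le_sum fun i _ => ?_
        rw [Set.indicator_of_mem]
        · exact hgM _
        · rw [hAiff]
          simpa [hxi] using (hAiff p).1 hpA
  calc (μ.prod μ) A ≤ 2 * (μ.prod μ) (A ∩ C) := hhalf
    _ ≤ 2 * (k * ∫⁻ p, A.indicator M p ∂(μ.prod μ)) := by gcongr
    _ = _ := by rw [hMint, mul_assoc]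

end Edge

theorem exists_odd_length {γ : ℝ} (hγ : 0 < γ) (hγ1 : γ < 1) :
    ∃ k : ℕ, Odd k ∧ 2 ≤ k ∧ 1 - Real.cos (Real.pi / k) ≤ γ / 8 ∧ k * √γ ≤ 11 := by
  have hspos := Real.sqrt_pos.2 hγ
  have hs := Real.sq_sqrt hγ.le
  have hs1 : √γ ≤ 1 := Real.sqrt_le_one.2 hγ1.le
  have h4 : 0 ≤ 4 / √γ := by positivity
  set n := ⌈4 / √γ⌉₊
  have hn : 4 / √γ ≤ n := Nat.le_ceil _
  have hn' : (n : ℝ) < 4 / √γ + 1 := Nat.ceil_lt_add_one h4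
  rw [div_le_iff₀ hspos] at hn
  have hn1 : 1 ≤ n := Nat.ceil_pos.2 (by positivity)
  refine ⟨2 * n + 1, ⟨n, rfl⟩, by lia, ?_, ?_⟩
  · have hc := Real.one_sub_sq_div_two_le_cos (x := Real.pi / (2 * n + 1 : ℕ))
    have hpi := Real.pi_lt_four
    have hle : Real.pi / (2 * n + 1 : ℕ) ≤ √γ / 2 := by
      rw [div_le_iff₀ (by positivity)]
      push_cast
      nlinarith
    have h0 : 0 ≤ Real.pi / (2 * n + 1 : ℕ) := by positivity
    nlinarith
  · push_cast
    have : (n : ℝ) * √γ ≤ 4 + √γ := by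
      calc (n : ℝ) * √γ ≤ (4 / √γ + 1) * √γ := by gcongr
        _ = 4 + √γ := by field_simp
    linarith

theorem measurePreserving_sphereRot_sphereUniform (d : ℕ)
    (S : EuclideanSpace ℝ (Fin d) ≃ₗᵢ[ℝ] EuclideanSpace ℝ (Fin d)) :
    MeasurePreserving (sphereRot S) (sphereUniform d) (sphereUniform d) :=
  (measurePreserving_sphereRot_toSphere S).smul_measure _

theorem isFiniteMeasure_sphereUniform {d : ℕ} (hd : 0 < d) :
    IsFiniteMeasure (sphereUniform d) := by
  have : Nonempty (Fin d) := ⟨⟨0, hd⟩⟩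
  refine Measure.smul_finite _ (ENNReal.inv_ne_top.2 ?_)
  rw [Ne, Measure.measure_univ_eq_zero]
  exact Measure.toSphere_ne_zero _

/-- **`sdp₃` of the continuous sphere graph.** There is an absolute constant `c > 0` such
that for every `γ ∈ (0,1)` there exists `d₀` such that for every `d ≥ d₀`, the value of
the triangle-inequality strengthened Max-Cut relaxation of the sphere graph `G_γ` — the
supremum, over all measurable maps `f` from `S^{d-1}` to the unit sphere of a Hilbert
space satisfying the `ℓ₂²` triangle inequalities, of `E_{(u,v)∼E} ¼‖f(u) − f(v)‖²` —
is at most `1 − c·√γ`. -/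
theorem sphere_graph_sdp3 :
    ∃ c : ℝ, 0 < c ∧
      ∀ γ : ℝ, 0 < γ → γ < 1 →
        ∃ d₀ : ℕ, ∀ d : ℕ, d₀ ≤ d →
          sSup {r : ℝ |
            ∃ (H : Type) (_ : NormedAddCommGroup H) (_ : InnerProductSpace ℝ H)
              (f : Metric.sphere (0 : EuclideanSpace ℝ (Fin d)) 1 → H),
              (∀ u, ‖f u‖ = 1) ∧
              (∀ u v w, ⟪f u, f v⟫ + ⟪f v, f w⟫ - ⟪f u, f w⟫ ≤ 1) ∧
              (∀ u v w, -1 ≤ ⟪f u, f v⟫ + ⟪f v, f w⟫ + ⟪f u, f w⟫) ∧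
              AEStronglyMeasurable (fun p => ‖f p.1 - f p.2‖ ^ 2 / 4)
                (sphereEdgeMeasure d γ) ∧
              r = ∫ p, ‖f p.1 - f p.2‖ ^ 2 / 4 ∂(sphereEdgeMeasure d γ)} ≤
            1 - c * Real.sqrt γ := by
  refine ⟨1 / 22, by norm_num, fun γ hγ hγ1 => ⟨3, fun d hd => ?_⟩⟩
  have hs1 : √γ ≤ 1 := Real.sqrt_le_one.2 hγ1.le
  refine Real.sSup_le ?_ (by linarith)
  rintro r ⟨H, _, _, f, hf, h₁, h₂, hmeas, rfl⟩
  obtain ⟨k, hk, hk2, hkγ, hkle⟩ := exists_odd_length hγ hγ1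
  have : IsFiniteMeasure (sphereUniform d) := isFiniteMeasure_sphereUniform (by lia)
  have he : Orthonormal ℝ fun i : Fin 3 => EuclideanSpace.basisFun (Fin d) ℝ (Fin.castLE hd i) :=
    (EuclideanSpace.basisFun (Fin d) ℝ).orthonormal.comp _ (Fin.castLE_injective hd)
  set ν := (sphereUniform d).prod (sphereUniform d)
  set A := {p : Metric.sphere (0 : EuclideanSpace ℝ (Fin d)) 1 ×
      Metric.sphere (0 : EuclideanSpace ℝ (Fin d)) 1 |
    1 - γ ≤ ‖(p.1 : EuclideanSpace ℝ (Fin d)) - (p.2 : EuclideanSpace ℝ (Fin d))‖ ^ 2 / 4}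
  have hE : sphereEdgeMeasure d γ = (ν A)⁻¹ • ν.restrict A := rfl
  rcases eq_or_ne (ν A) 0 with h0 | h0
  · have hzero : sphereEdgeMeasure d γ = 0 := ProbabilityTheory.cond_eq_zero_of_meas_eq_zero h0
    rw [hzero, integral_zero_measure]
    linarith
  have hprob : IsProbabilityMeasure (sphereEdgeMeasure d γ) :=
    ProbabilityTheory.cond_isProbabilityMeasure h0
  have hfin : ν A ≠ ⊤ := measure_ne_top _ _
  have hgh : ∀ p : Metric.sphere (0 : EuclideanSpace ℝ (Fin d)) 1 ×
      Metric.sphere (0 : EuclideanSpace ℝ (Fin d)) 1,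
      ‖f p.1 - f p.2‖ ^ 2 / 4 = 1 - (1 + ⟪f p.1, f p.2⟫) / 2 := by
    intro p
    rw [norm_sub_sq_real, hf, hf]
    ring
  have hinner : ∀ u v, |⟪f u, f v⟫| ≤ 1 := fun u v => by
    simpa [hf] using abs_real_inner_le_norm (f u) (f v)
  simp only [hgh] at hmeas ⊢
  have hmeas' : AEStronglyMeasurable (fun p => (1 + ⟪f p.1, f p.2⟫) / 2)
      (sphereEdgeMeasure d γ) := by
    simpa [Pi.sub_def] using (aestronglyMeasurable_const (b := (1 : ℝ))).sub hmeas
  have hint : Integrable (fun p => (1 + ⟪f p.1, f p.2⟫) / 2) (sphereEdgeMeasure d γ) := by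
    refine Integrable.of_bound hmeas' 1 (Filter.Eventually.of_forall fun p => ?_)
    rw [Real.norm_eq_abs, abs_le]
    constructor <;> linarith [abs_le.1 (hinner p.1 p.2)]
  have hac : ν.restrict A ≪ sphereEdgeMeasure d γ := by
    rw [hE]
    exact Measure.AbsolutelyContinuous.rfl.smul_right (ENNReal.inv_ne_zero.2 hfin)
  have hkey := measure_edge_le_mul_lintegral (sphereUniform d)
    (measurePreserving_sphereRot_sphereUniform d) he hγ hγ1 hk hk2 hkγ hf h₁ h₂
    (hmeas'.aemeasurable.ennreal_ofReal.mono_ac hac)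
  rw [integral_sub (integrable_const _) hint, integral_const, probReal_univ, smul_eq_mul,
    integral_eq_lintegral_of_nonneg_ae (Filter.Eventually.of_forall fun p => by
      simp only [Pi.zero_apply]; linarith [abs_le.1 (hinner p.1 p.2)]) hmeas']
  have hlow : 1 ≤ 2 * k * ∫⁻ p, ENNReal.ofReal ((1 + ⟪f p.1, f p.2⟫) / 2)
      ∂(sphereEdgeMeasure d γ) := by
    rw [hE, lintegral_smul_measure, smul_eq_mul, mul_left_comm, ← ENNReal.inv_mul_cancel h0 hfin]
    gcongr
  have hlt : ∫⁻ p, ENNReal.ofReal ((1 + ⟪f p.1, f p.2⟫) / 2) ∂(sphereEdgeMeasure d γ) ≠ ⊤ :=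
    hint.lintegral_lt_top.ne
  have hreal := ENNReal.toReal_mono (ENNReal.mul_ne_top (by finiteness) hlt) hlow
  rw [ENNReal.toReal_mul, ENNReal.toReal_mul] at hreal
  simp only [ENNReal.toReal_one, ENNReal.toReal_ofNat, ENNReal.toReal_natCast] at hreal
  set I := (∫⁻ p, ENNReal.ofReal ((1 + ⟪f p.1, f p.2⟫) / 2) ∂(sphereEdgeMeasure d γ)).toReal
  have hI : 0 ≤ I := ENNReal.toReal_nonneg
  have : √γ ≤ 22 * I := by
    calc √γ ≤ √γ * (2 * k * I) := le_mul_of_one_le_right (Real.sqrt_nonneg _) hreal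
      _ = 2 * I * (k * √γ) := by ring
      _ ≤ 2 * I * 11 := by gcongr
      _ = 22 * I := by ring
  linarith
end
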